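/- For all indices α, β ∈ {1,2} and all (u,t) ∈ Ω × I, the second fundamental form of the evolving surface satisfies ∂_t b_{αβ} = vⁿ_{,αβ} − vⁿ b^γ_α b_{γβ} + v^γ_{,β} b_{αγ} + v^γ_{,α} b_{γβ} + v^γ b_{αβ,γ}. -/

import Mathlib

noncomputable section

open scoped Real BigOperators

/-- Vectors in ℝ³. -/
abbrev V3 := Fin 3 → ℝ

def dot3 (v w : V3) : ℝ := v 0 * w 0 + v 1 * w 1 + v 2 * w 2

def cross3 (v w : V3) : V3 :=
  ![v 1 * w 2 - v 2 * w 1, v 2 * w 0 - v 0 * w 2, v 0 * w 1 - v 1 * w 0]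

def norm3 (v : V3) : ℝ := Real.sqrt (dot3 v v)

/-- A space-time point `(u, t) ∈ ℝ² × ℝ`. -/
abbrev Pt := (ℝ × ℝ) × ℝ

/-- Spatial coordinate directions. -/
def sdir : Fin 2 → Pt := ![((1,0),0), ((0,1),0)]

/-- Spatial partial derivative `∂_α` of a scalar function on space-time. -/
def pdS (α : Fin 2) (f : Pt → ℝ) : Pt → ℝ := fun p => fderiv ℝ f p (sdir α)

/-- Time derivative `∂_t` of a scalar function on space-time. -/
def pdT (f : Pt → ℝ) : Pt → ℝ := fun p => fderiv ℝ f p ((0,0),1)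

variable (R : Pt → V3)

/-- Tangent vector `a_α = ∂_α R`. -/
def aV (α : Fin 2) : Pt → V3 := fun p i => pdS α (fun q => R q i) p

/-- Metric tensor `a_{αβ} = a_α · a_β`. -/
def met (α β : Fin 2) : Pt → ℝ := fun p => dot3 (aV R α p) (aV R β p)

/-- Inverse metric `(a^{αβ})`. -/
def metInv (p : Pt) : Matrix (Fin 2) (Fin 2) ℝ := (Matrix.of fun α β => met R α β p)⁻¹

/-- Unit normal `n = (a₁ × a₂)/|a₁ × a₂|`. -/
def nor : Pt → V3 := fun p i =>
  cross3 (aV R 0 p) (aV R 1 p) i / norm3 (cross3 (aV R 0 p) (aV R 1 p))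

/-- Second fundamental form `b_{αβ} = ∂_α∂_β R · n`. -/
def bform (α β : Fin 2) : Pt → ℝ := fun p =>
  dot3 (fun i => pdS α (fun q => pdS β (fun r => R r i) q) p) (nor R p)

/-- Mixed second fundamental form `b^α_β = a^{αγ} b_{γβ}`. -/
def bMix (α β : Fin 2) : Pt → ℝ := fun p => ∑ γ : Fin 2, metInv R p α γ * bform R γ β p

/-- Christoffel symbols `Γ^γ_{αβ} = ½ a^{γδ}(∂_α a_{βδ} + ∂_β a_{αδ} − ∂_δ a_{αβ})`. -/
def chris (γ α β : Fin 2) : Pt → ℝ := fun p =>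
  (1/2) * ∑ δ : Fin 2, metInv R p γ δ *
    (pdS α (met R β δ) p + pdS β (met R α δ) p - pdS δ (met R α β) p)

/-- Velocity `v = ∂_t R`. -/
def vel : Pt → V3 := fun p i => pdT (fun q => R q i) p

/-- Contravariant components `v^α = a^{αβ}(v·a_β)`. -/
def vUp (α : Fin 2) : Pt → ℝ := fun p => ∑ β : Fin 2, metInv R p α β * dot3 (vel R p) (aV R β p)

/-- Normal component `vⁿ = v·n`. -/
def vN : Pt → ℝ := fun p => dot3 (vel R p) (nor R p)

/-- Covariant components `v_α = a_{αβ} v^β`. -/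
def vLow (α : Fin 2) : Pt → ℝ := fun p => ∑ β : Fin 2, met R α β p * vUp R β p

/-- Covariant derivative `v_{α,β} = ∂_β v_α − Γ^γ_{αβ} v_γ`. -/
def vLowCov (α β : Fin 2) : Pt → ℝ := fun p =>
  pdS β (vLow R α) p - ∑ γ : Fin 2, chris R γ α β p * vLow R γ p

/-- Covariant derivative `v^γ_{,β} = ∂_β v^γ + Γ^γ_{δβ} v^δ`. -/
def vUpCov (γ β : Fin 2) : Pt → ℝ := fun p =>
  pdS β (vUp R γ) p + ∑ δ : Fin 2, chris R γ δ β p * vUp R δ p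

/-- Covariant second derivative `vⁿ_{,αβ} = ∂_β∂_α vⁿ − Γ^γ_{αβ} ∂_γ vⁿ`. -/
def vNCov2 (α β : Fin 2) : Pt → ℝ := fun p =>
  pdS β (pdS α (vN R)) p - ∑ γ : Fin 2, chris R γ α β p * pdS γ (vN R) p

/-- Covariant derivative of the second fundamental form
`b_{αβ,γ} = ∂_γ b_{αβ} − Γ^δ_{αγ} b_{δβ} − Γ^δ_{βγ} b_{αδ}`. -/
def bCov (α β γ : Fin 2) : Pt → ℝ := fun p =>
  pdS γ (bform R α β) p - (∑ δ : Fin 2, chris R δ α γ p * bform R δ β p)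
    - ∑ δ : Fin 2, chris R δ β γ p * bform R α δ p

/-- Mean curvature `H = ½ a^{αβ} b_{αβ}`. -/
def meanH : Pt → ℝ := fun p =>
  (1/2) * ∑ α : Fin 2, ∑ β : Fin 2, metInv R p α β * bform R α β p


def DD (d : Pt) (f : Pt → ℝ) : Pt → ℝ := fun p => fderiv ℝ f p d
def DV (d : Pt) (F : Pt → V3) : Pt → V3 := fun p i => DD d (fun q => F q i) p
def SmS (U : Set Pt) (f : Pt → ℝ) : Prop := ∀ p ∈ U, ContDiffAt ℝ ((⊤ : ℕ∞) : WithTop ℕ∞) f p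
def SmV (U : Set Pt) (F : Pt → V3) : Prop := ∀ i, SmS U (fun q => F q i)
def tdir : Pt := ((0,0),1)

section helpers
variable {U : Set Pt}

theorem SmS.diff {f : Pt → ℝ} (h : SmS U f) {p} (hp : p ∈ U) : DifferentiableAt ℝ f p :=
  (h p hp).differentiableAt (by simp)

theorem SmS.DD {f : Pt → ℝ} (h : SmS U f) (d : Pt) : SmS U (DD d f) := by
  intro p hp
  have h1 : ContDiffAt ℝ ((⊤ : ℕ∞) : WithTop ℕ∞) (fderiv ℝ f) p :=
    (h p hp).fderiv_right (by simp)
  exact h1.clm_apply contDiffAt_const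

theorem SmS.add {f g : Pt → ℝ} (hf : SmS U f) (hg : SmS U g) : SmS U (fun p => f p + g p) :=
  fun p hp => (hf p hp).add (hg p hp)
theorem SmS.sub {f g : Pt → ℝ} (hf : SmS U f) (hg : SmS U g) : SmS U (fun p => f p - g p) :=
  fun p hp => (hf p hp).sub (hg p hp)
theorem SmS.mul {f g : Pt → ℝ} (hf : SmS U f) (hg : SmS U g) : SmS U (fun p => f p * g p) :=
  fun p hp => (hf p hp).mul (hg p hp)

theorem SmV.DV {F : Pt → V3} (h : SmV U F) (d : Pt) : SmV U (DV d F) := fun i => (h i).DD d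

theorem SmV.dot {F G : Pt → V3} (hF : SmV U F) (hG : SmV U G) :
    SmS U (fun p => dot3 (F p) (G p)) :=
  (((hF 0).mul (hG 0)).add ((hF 1).mul (hG 1))).add ((hF 2).mul (hG 2))

theorem DD_add {f g : Pt → ℝ} (hf : SmS U f) (hg : SmS U g) (d : Pt) {p} (hp : p ∈ U) :
    DD d (fun p => f p + g p) p = DD d f p + DD d g p := by
  simp only [DD]
  rw [fderiv_fun_add (hf.diff hp) (hg.diff hp)]; rfl

theorem DD_mul {f g : Pt → ℝ} (hf : SmS U f) (hg : SmS U g) (d : Pt) {p} (hp : p ∈ U) :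
    DD d (fun p => f p * g p) p = DD d f p * g p + f p * DD d g p := by
  simp only [DD]
  rw [fderiv_fun_mul (hf.diff hp) (hg.diff hp)]
  simp; ring

theorem DD_dot {F G : Pt → V3} (hF : SmV U F) (hG : SmV U G) (d : Pt) {p} (hp : p ∈ U) :
    DD d (fun p => dot3 (F p) (G p)) p = dot3 (DV d F p) (G p) + dot3 (F p) (DV d G p) := by
  unfold dot3
  rw [DD_add (((hF 0).mul (hG 0)).add ((hF 1).mul (hG 1))) ((hF 2).mul (hG 2)) d hp,
    DD_add ((hF 0).mul (hG 0)) ((hF 1).mul (hG 1)) d hp, DD_mul (hF 0) (hG 0) d hp,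
    DD_mul (hF 1) (hG 1) d hp, DD_mul (hF 2) (hG 2) d hp]
  simp only [DV]; ring

theorem DD_congr (hU : IsOpen U) {f g : Pt → ℝ} (h : ∀ p ∈ U, f p = g p) (d : Pt) {p}
    (hp : p ∈ U) : DD d f p = DD d g p := by
  simp only [DD]
  rw [Filter.EventuallyEq.fderiv_eq]
  filter_upwards [hU.mem_nhds hp] with q hq using h q hq

theorem DD_const (hU : IsOpen U) {f : Pt → ℝ} {c : ℝ} (h : ∀ p ∈ U, f p = c) (d : Pt) {p}
    (hp : p ∈ U) : DD d f p = 0 := by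
  rw [DD_congr hU (g := fun _ => c) h d hp]; simp [DD]

theorem DD_comm {f : Pt → ℝ} (h : SmS U f) (d e : Pt) {p} (hp : p ∈ U) :
    DD d (DD e f) p = DD e (DD d f) p := by
  have h1 : ContDiffAt ℝ ((⊤ : ℕ∞) : WithTop ℕ∞) (fderiv ℝ f) p :=
    (h p hp).fderiv_right (by simp)
  have h2 := h1.differentiableAt (by simp)
  have key : ∀ d e : Pt, DD d (DD e f) p = fderiv ℝ (fderiv ℝ f) p d e := by
    intro d e
    change fderiv ℝ (fun q => fderiv ℝ f q e) p d = _
    rw [fderiv_clm_apply h2 (differentiableAt_const e)]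
    simp
  rw [key, key]
  have h3 := (h p hp).isSymmSndFDerivAt (by simp; exact WithTop.coe_le_coe.2 (le_top : (2 : ℕ∞) ≤ ⊤))
  exact h3 d e

theorem DV_comm (hU : IsOpen U) {F : Pt → V3} (h : SmV U F) (d e : Pt) {p} (hp : p ∈ U) :
    DV d (DV e F) p = DV e (DV d F) p := by
  funext i
  exact DD_comm (h i) d e hp

theorem DV_congr (hU : IsOpen U) {F G : Pt → V3} (h : ∀ p ∈ U, F p = G p) (d : Pt) {p}
    (hp : p ∈ U) : DV d F p = DV d G p := by
  funext i
  exact DD_congr hU (fun q hq => by rw [h q hq]) d hp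

theorem dot3_comm (v w : V3) : dot3 v w = dot3 w v := by unfold dot3; ring

end helpers

theorem lagrange (a b : V3) : dot3 (cross3 a b) (cross3 a b) =
    dot3 a a * dot3 b b - dot3 a b * dot3 a b := by
  simp [dot3, cross3]; ring

theorem cross_pos {a b : V3} (h : LinearIndependent ℝ ![a, b]) :
    0 < dot3 (cross3 a b) (cross3 a b) := by
  by_contra hc
  have h0 : cross3 a b 0 = 0 ∧ cross3 a b 1 = 0 ∧ cross3 a b 2 = 0 := by
    unfold dot3 at hc
    refine ⟨?_, ?_, ?_⟩ <;>
    nlinarith [mul_self_nonneg (cross3 a b 0), mul_self_nonneg (cross3 a b 1),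
      mul_self_nonneg (cross3 a b 2)]
  simp only [cross3, Matrix.cons_val_zero, Matrix.cons_val_one, Matrix.cons_val] at h0
  obtain ⟨h1, h2, h3⟩ := h0
  rw [LinearIndependent.pair_iff] at h
  have key : ∀ j, a j = 0 := by
    intro j
    have := h (b j) (-a j) (by
      funext i
      fin_cases i <;> fin_cases j <;> simp <;> linarith)
    linarith [this.2]
  have := h 1 0 (by funext i; simp [key])
  simp at this

section geom
variable {U : Set Pt} {R : Pt → V3}

theorem det_pos (hind : ∀ p ∈ U, LinearIndependent ℝ ![aV R 0 p, aV R 1 p]) {p} (hp : p ∈ U) :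
    0 < met R 0 0 p * met R 1 1 p - met R 0 1 p * met R 0 1 p := by
  have := cross_pos (hind p hp)
  rw [lagrange] at this
  exact this

theorem met_symm (α β : Fin 2) (p) : met R α β p = met R β α p := dot3_comm _ _

theorem metInv_formula (p : Pt) : metInv R p =
    (met R 0 0 p * met R 1 1 p - met R 0 1 p * met R 0 1 p)⁻¹ •
      !![met R 1 1 p, - met R 0 1 p; - met R 0 1 p, met R 0 0 p] := by
  unfold metInv
  rw [Matrix.inv_def, Matrix.adjugate_fin_two, Matrix.det_fin_two]
  simp [met_symm 1 0]

theorem metInv_symm (α β : Fin 2) (p : Pt) : metInv R p α β = metInv R p β α := by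
  rw [metInv_formula]; fin_cases α <;> fin_cases β <;> simp

theorem metInv_mul (hind : ∀ p ∈ U, LinearIndependent ℝ ![aV R 0 p, aV R 1 p]) {p} (hp : p ∈ U)
    (α β : Fin 2) : metInv R p α 0 * met R 0 β p + metInv R p α 1 * met R 1 β p =
      if α = β then 1 else 0 := by
  have hk := mul_inv_cancel₀ (det_pos hind hp).ne'
  rw [metInv_formula]
  generalize (met R 0 0 p * met R 1 1 p - met R 0 1 p * met R 0 1 p)⁻¹ = k at *
  fin_cases α <;> fin_cases β <;> simp [met_symm 1 0]
  · linear_combination hk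
  · ring
  · ring
  · linear_combination hk

theorem parseval (hind : ∀ p ∈ U, LinearIndependent ℝ ![aV R 0 p, aV R 1 p]) {p} (hp : p ∈ U)
    (X Y : V3) : dot3 X Y = (∑ γ : Fin 2, ∑ δ : Fin 2,
      metInv R p γ δ * dot3 X (aV R γ p) * dot3 Y (aV R δ p)) +
      dot3 X (nor R p) * dot3 Y (nor R p) := by
  have hc := cross_pos (hind p hp)
  have h0 := (det_pos hind hp).ne'
  have hn : dot3 X (nor R p) * dot3 Y (nor R p) =
      dot3 X (cross3 (aV R 0 p) (aV R 1 p)) * dot3 Y (cross3 (aV R 0 p) (aV R 1 p)) *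
       (met R 0 0 p * met R 1 1 p - met R 0 1 p * met R 0 1 p)⁻¹ := by
    have : (met R 0 0 p * met R 1 1 p - met R 0 1 p * met R 0 1 p) =
      norm3 (cross3 (aV R 0 p) (aV R 1 p)) * norm3 (cross3 (aV R 0 p) (aV R 1 p)) := by
      unfold norm3
      rw [Real.mul_self_sqrt hc.le, lagrange]; rfl
    rw [this]
    simp only [nor, dot3, div_eq_mul_inv, mul_inv]
    ring
  have hk := mul_inv_cancel₀ h0
  rw [hn, metInv_formula]
  generalize (met R 0 0 p * met R 1 1 p - met R 0 1 p * met R 0 1 p)⁻¹ = k at *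
  simp [Fin.sum_univ_two]
  simp [met, dot3, cross3] at hk ⊢
  linear_combination (-(X 0 * Y 0 + X 1 * Y 1 + X 2 * Y 2)) * hk

theorem nor_nor (hind : ∀ p ∈ U, LinearIndependent ℝ ![aV R 0 p, aV R 1 p]) {p} (hp : p ∈ U) :
    dot3 (nor R p) (nor R p) = 1 := by
  have hc := cross_pos (hind p hp)
  have h2 : norm3 (cross3 (aV R 0 p) (aV R 1 p)) * norm3 (cross3 (aV R 0 p) (aV R 1 p)) = _ :=
    Real.mul_self_sqrt hc.le
  have h1 : norm3 (cross3 (aV R 0 p) (aV R 1 p)) ≠ 0 := (Real.sqrt_pos.2 hc).ne'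
  simp only [nor, dot3] at *
  field_simp
  linarith

theorem nor_aV (γ : Fin 2) (p : Pt) : dot3 (nor R p) (aV R γ p) = 0 := by
  simp only [nor, dot3, cross3]
  fin_cases γ <;> simp <;> ring

theorem sm_aV (hR : SmV U R) (α : Fin 2) : SmV U (aV R α) := hR.DV (sdir α)
theorem sm_vel (hR : SmV U R) : SmV U (vel R) := hR.DV tdir
theorem sm_met (hR : SmV U R) (α β : Fin 2) : SmS U (met R α β) :=
  (sm_aV hR α).dot (sm_aV hR β)

theorem sm_nor (hR : SmV U R) (hind : ∀ p ∈ U, LinearIndependent ℝ ![aV R 0 p, aV R 1 p]) :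
    SmV U (nor R) := by
  have hc : SmV U (fun p => cross3 (aV R 0 p) (aV R 1 p)) := by
    have h0 := sm_aV hR 0
    have h1 := sm_aV hR 1
    intro i
    fin_cases i
    · exact ((h0 1).mul (h1 2)).sub ((h0 2).mul (h1 1))
    · exact ((h0 2).mul (h1 0)).sub ((h0 0).mul (h1 2))
    · exact ((h0 0).mul (h1 1)).sub ((h0 1).mul (h1 0))
  intro i p hp
  exact (hc i p hp).div ((hc.dot hc p hp).sqrt (cross_pos (hind p hp)).ne')
    (Real.sqrt_pos.2 (cross_pos (hind p hp))).ne'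

theorem sm_metInv (hR : SmV U R) (hind : ∀ p ∈ U, LinearIndependent ℝ ![aV R 0 p, aV R 1 p])
    (α β : Fin 2) : SmS U (fun p => metInv R p α β) := by
  intro p hp
  have hd := (((((sm_met hR 0 0).mul (sm_met hR 1 1)).sub
    ((sm_met hR 0 1).mul (sm_met hR 0 1)))) p hp).inv (det_pos hind hp).ne'
  have : (fun p => metInv R p α β) = fun p =>
    (met R 0 0 p * met R 1 1 p - met R 0 1 p * met R 0 1 p)⁻¹ *
      !![met R 1 1 p, - met R 0 1 p; - met R 0 1 p, met R 0 0 p] α β := by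
    funext q; rw [metInv_formula]; simp
  rw [this]
  refine hd.mul ?_
  fin_cases α <;> fin_cases β
  · exact sm_met hR 1 1 p hp
  · exact (sm_met hR 0 1 p hp).neg
  · exact (sm_met hR 0 1 p hp).neg
  · exact sm_met hR 0 0 p hp

theorem sm_vUp (hR : SmV U R) (hind : ∀ p ∈ U, LinearIndependent ℝ ![aV R 0 p, aV R 1 p])
    (α : Fin 2) : SmS U (vUp R α) := by
  have : vUp R α = fun p => metInv R p α 0 * dot3 (vel R p) (aV R 0 p) +
    metInv R p α 1 * dot3 (vel R p) (aV R 1 p) := by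
    funext p; simp [vUp, Fin.sum_univ_two]
  rw [this]
  exact ((sm_metInv hR hind α 0).mul ((sm_vel hR).dot (sm_aV hR 0))).add
    ((sm_metInv hR hind α 1).mul ((sm_vel hR).dot (sm_aV hR 1)))

theorem bform_eq (α β : Fin 2) : bform R α β =
  fun p => dot3 (DV (sdir α) (aV R β) p) (nor R p) := rfl

theorem sm_bform (hR : SmV U R) (hind : ∀ p ∈ U, LinearIndependent ℝ ![aV R 0 p, aV R 1 p])
    (α β : Fin 2) : SmS U (bform R α β) :=
  ((sm_aV hR β).DV (sdir α)).dot (sm_nor hR hind)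

theorem sm_vN (hR : SmV U R) (hind : ∀ p ∈ U, LinearIndependent ℝ ![aV R 0 p, aV R 1 p]) :
    SmS U (vN R) := (sm_vel hR).dot (sm_nor hR hind)


structure Geo (U : Set Pt) (R : Pt → V3) : Prop where
  hU : IsOpen U
  hR : SmV U R
  hind : ∀ p ∈ U, LinearIndependent ℝ ![aV R 0 p, aV R 1 p]

theorem daV_symm (g : Geo U R) (α β : Fin 2) {p} (hp : p ∈ U) :
    DV (sdir α) (aV R β) p = DV (sdir β) (aV R α) p := DV_comm g.hU g.hR _ _ hp

theorem bform_symm (g : Geo U R) (α β : Fin 2) {p} (hp : p ∈ U) :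
    bform R α β p = bform R β α p := by
  simp only [bform_eq]; rw [daV_symm g α β hp]

theorem daV_t (g : Geo U R) (α : Fin 2) {p} (hp : p ∈ U) :
    DV tdir (aV R α) p = DV (sdir α) (vel R) p := DV_comm g.hU g.hR _ _ hp

theorem dn_n (g : Geo U R) (d : Pt) {p} (hp : p ∈ U) :
    dot3 (DV d (nor R) p) (nor R p) = 0 := by
  have sn := sm_nor g.hR g.hind
  have h := DD_const g.hU (fun q hq => nor_nor g.hind hq) d hp
  rw [DD_dot sn sn d hp, dot3_comm (nor R p)] at h
  linarith

theorem dn_a (g : Geo U R) (d : Pt) (γ : Fin 2) {p} (hp : p ∈ U) :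
    dot3 (DV d (nor R) p) (aV R γ p) = - dot3 (DV d (aV R γ) p) (nor R p) := by
  have sn := sm_nor g.hR g.hind
  have h := DD_const g.hU (fun q _ => nor_aV (R := R) γ q) d hp
  rw [DD_dot sn (sm_aV g.hR γ) d hp, dot3_comm (nor R p)] at h
  linarith

theorem dn_s (g : Geo U R) (α γ : Fin 2) {p} (hp : p ∈ U) :
    dot3 (DV (sdir α) (nor R) p) (aV R γ p) = - bform R α γ p := dn_a g _ γ hp

/-- Christoffel symbols via second derivatives. -/
theorem chris_eq (g : Geo U R) (γ α β : Fin 2) {p} (hp : p ∈ U) :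
    chris R γ α β p = ∑ δ : Fin 2, metInv R p γ δ *
      dot3 (DV (sdir α) (aV R β) p) (aV R δ p) := by
  have hm : ∀ α β δ : Fin 2, pdS α (met R β δ) p =
      dot3 (DV (sdir α) (aV R β) p) (aV R δ p) + dot3 (DV (sdir α) (aV R δ) p) (aV R β p) := by
    intro α β δ
    rw [dot3_comm _ (aV R β p)]
    exact DD_dot (sm_aV g.hR β) (sm_aV g.hR δ) _ hp
  have hs : ∀ δ : Fin 2, pdS α (met R β δ) p + pdS β (met R α δ) p - pdS δ (met R α β) p =
      2 * dot3 (DV (sdir α) (aV R β) p) (aV R δ p) := by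
    intro δ
    rw [hm, hm, hm, daV_symm g β α hp, daV_symm g δ α hp, daV_symm g δ β hp]; ring
  simp only [chris, hs, Fin.sum_univ_two]
  ring

theorem chris_symm (g : Geo U R) (γ α β : Fin 2) {p} (hp : p ∈ U) :
    chris R γ α β p = chris R γ β α p := by
  rw [chris_eq g _ _ _ hp, chris_eq g _ _ _ hp, daV_symm g α β hp]

/-- Gauss: pairing `∂_α a_β` with a vector. -/
theorem gauss (g : Geo U R) (α β : Fin 2) (X : V3) {p} (hp : p ∈ U) :
    dot3 (DV (sdir α) (aV R β) p) X = (∑ γ : Fin 2, chris R γ α β p * dot3 X (aV R γ p)) +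
      bform R α β p * dot3 X (nor R p) := by
  rw [parseval g.hind hp]
  simp only [chris_eq g _ _ _ hp, bform_eq, Fin.sum_univ_two, metInv_symm 1 0]
  ring

/-- Weingarten: pairing `∂_α n` with a vector. -/
theorem weing (g : Geo U R) (α : Fin 2) (X : V3) {p} (hp : p ∈ U) :
    dot3 X (DV (sdir α) (nor R) p) = - ∑ γ : Fin 2, bform R α γ p *
      ∑ δ : Fin 2, metInv R p γ δ * dot3 X (aV R δ p) := by
  rw [parseval g.hind hp, dn_n g _ hp]
  simp only [dn_s g _ _ hp, Fin.sum_univ_two, metInv_symm 1 0]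
  ring

/-- `w_γ = ∂_γ v · n`. -/
def ww (R : Pt → V3) (γ : Fin 2) : Pt → ℝ := fun p => dot3 (DV (sdir γ) (vel R) p) (nor R p)

theorem ww_eq (g : Geo U R) (γ : Fin 2) {p} (hp : p ∈ U) :
    ww R γ p = pdS γ (vN R) p + ∑ ε : Fin 2, vUp R ε p * bform R γ ε p := by
  have h : pdS γ (vN R) p = _ := DD_dot (sm_vel g.hR) (sm_nor g.hR g.hind) (sdir γ) hp
  rw [h, weing g _ _ hp]
  simp only [ww, vUp, Fin.sum_univ_two]
  ring

theorem dt_b (g : Geo U R) (α β : Fin 2) {p} (hp : p ∈ U) :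
    pdT (bform R α β) p = dot3 (DV (sdir β) (DV (sdir α) (vel R)) p) (nor R p) -
      ∑ γ : Fin 2, chris R γ α β p * ww R γ p := by
  have h : pdT (bform R α β) p = _ :=
    DD_dot ((sm_aV g.hR β).DV (sdir α)) (sm_nor g.hR g.hind) tdir hp
  have e : DV tdir (DV (sdir α) (aV R β)) p = DV (sdir β) (DV (sdir α) (vel R)) p := by
    rw [DV_congr g.hU (fun q hq => daV_symm g α β hq) tdir hp,
      DV_comm g.hU (sm_aV g.hR α) _ _ hp]
    exact DV_congr g.hU (fun q hq => daV_t g α hq) _ hp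
  rw [h, e, gauss g _ _ _ hp, dn_n g _ hp]
  simp only [dn_a g _ _ hp, daV_t g _ hp, Fin.sum_univ_two, ww]
  ring

theorem codazzi (g : Geo U R) (α β γ : Fin 2) {p} (hp : p ∈ U) :
    pdS γ (bform R α β) p = dot3 (DV (sdir γ) (DV (sdir α) (aV R β)) p) (nor R p) -
      ∑ δ : Fin 2, chris R δ α β p * bform R γ δ p := by
  have h : pdS γ (bform R α β) p = _ :=
    DD_dot ((sm_aV g.hR β).DV (sdir α)) (sm_nor g.hR g.hind) (sdir γ) hp
  rw [h, gauss g _ _ _ hp, dn_n g _ hp]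
  simp only [dn_s g _ _ hp, Fin.sum_univ_two]
  ring

theorem codazzi' (g : Geo U R) (α β γ : Fin 2) {p} (hp : p ∈ U) :
    pdS β (bform R α γ) p + ∑ δ : Fin 2, chris R δ α γ p * bform R β δ p =
    pdS γ (bform R α β) p + ∑ δ : Fin 2, chris R δ α β p * bform R γ δ p := by
  have e : DV (sdir β) (DV (sdir α) (aV R γ)) p = DV (sdir γ) (DV (sdir α) (aV R β)) p := by
    rw [DV_congr g.hU (fun q hq => daV_symm g α γ hq) _ hp,
      DV_comm g.hU (sm_aV g.hR α) _ _ hp]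
    exact DV_congr g.hU (fun q hq => daV_symm g β α hq) _ hp
  rw [codazzi g _ _ _ hp, codazzi g _ _ _ hp, e]
  ring

theorem met_vUp (g : Geo U R) (δ : Fin 2) {p} (hp : p ∈ U) :
    met R δ 0 p * vUp R 0 p + met R δ 1 p * vUp R 1 p = dot3 (vel R p) (aV R δ p) := by
  have h00 := metInv_mul g.hind hp 0 δ
  have h10 := metInv_mul g.hind hp 1 δ
  simp only [vUp, Fin.sum_univ_two]
  rw [metInv_symm 1 0] at *
  rw [met_symm δ 0, met_symm δ 1]
  fin_cases δ
  · simp at h00 h10 ⊢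
    linear_combination dot3 (vel R p) (aV R 0 p) * h00 + dot3 (vel R p) (aV R 1 p) * h10
  · simp at h00 h10 ⊢
    linear_combination dot3 (vel R p) (aV R 0 p) * h00 + dot3 (vel R p) (aV R 1 p) * h10

theorem dv_a (g : Geo U R) (β δ : Fin 2) {p} (hp : p ∈ U) :
    dot3 (DV (sdir β) (vel R) p) (aV R δ p) =
      ∑ ε : Fin 2, (met R δ ε p * pdS β (vUp R ε) p +
        dot3 (DV (sdir β) (aV R ε) p) (aV R δ p) * vUp R ε p) - vN R p * bform R β δ p := by
  have sv := sm_vUp g.hR g.hind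
  have sm := sm_met g.hR
  have h := DD_congr g.hU (fun q hq => met_vUp g δ hq) (sdir β) hp
  rw [DD_dot (sm_vel g.hR) (sm_aV g.hR δ) _ hp,
    DD_add ((sm δ 0).mul (sv 0)) ((sm δ 1).mul (sv 1)) _ hp,
    DD_mul (sm δ 0) (sv 0) _ hp, DD_mul (sm δ 1) (sv 1) _ hp,
    dot3_comm (vel R p), gauss g β δ (vel R p) hp] at h
  have hm : ∀ ε : Fin 2, DD (sdir β) (met R δ ε) p =
      dot3 (DV (sdir β) (aV R δ) p) (aV R ε p) + dot3 (DV (sdir β) (aV R ε) p) (aV R δ p) := by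
    intro ε
    rw [dot3_comm _ (aV R δ p)]
    exact DD_dot (sm_aV g.hR δ) (sm_aV g.hR ε) _ hp
  rw [hm, hm, gauss g β δ (aV R 0 p) hp, gauss g β δ (aV R 1 p) hp] at h
  rw [dot3_comm _ (nor R p), dot3_comm _ (nor R p), nor_aV, nor_aV] at h
  simp only [Fin.sum_univ_two] at h ⊢
  have m0 := met_vUp g 0 hp
  have m1 := met_vUp g 1 hp
  simp only [met, vN] at *
  simp only [pdS, DD] at *
  rw [dot3_comm (aV R 1 p) (aV R 0 p)] at *
  linear_combination -h + chris R 0 β δ p * m0 + chris R 1 β δ p * m1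

theorem up_dv (g : Geo U R) (β γ : Fin 2) {p} (hp : p ∈ U) :
    ∑ δ : Fin 2, metInv R p γ δ * dot3 (DV (sdir β) (vel R) p) (aV R δ p) =
      vUpCov R γ β p - vN R p * bMix R γ β p := by
  have h0 := metInv_mul g.hind hp γ 0
  have h1 := metInv_mul g.hind hp γ 1
  have hv : pdS β (vUp R γ) p = (if γ = 0 then 1 else 0) * pdS β (vUp R 0) p +
    (if γ = 1 then 1 else 0) * pdS β (vUp R 1) p := by
    fin_cases γ <;> simp
  simp only [vUpCov, bMix, dv_a g _ _ hp, hv, ← h0, ← h1, chris_symm g γ _ β hp,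
    chris_eq g _ _ _ hp, Fin.sum_univ_two, bform_symm g β _ hp]
  ring

theorem main (g : Geo U R) (α β : Fin 2) {p} (hp : p ∈ U) :
      pdT (bform R α β) p =
        vNCov2 R α β p
          - vN R p * (∑ γ : Fin 2, bMix R γ α p * bform R γ β p)
          + (∑ γ : Fin 2, vUpCov R γ β p * bform R α γ p)
          + (∑ γ : Fin 2, vUpCov R γ α p * bform R γ β p)
          + ∑ γ : Fin 2, vUp R γ p * bCov R α β γ p := by
  have sv := sm_vUp g.hR g.hind
  have sb := sm_bform g.hR g.hind
  have s1 := dt_b g α β hp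
  have s3 : DD (sdir β) (ww R α) p = _ :=
    DD_dot ((sm_vel g.hR).DV (sdir α)) (sm_nor g.hR g.hind) (sdir β) hp
  rw [weing g _ _ hp] at s3
  simp only [up_dv g _ _ hp] at s3
  have s4 := DD_congr g.hU (fun q hq => ww_eq g α hq) (sdir β) hp
  simp only [Fin.sum_univ_two] at s4
  have svn : SmS U (pdS α (vN R)) := (sm_vN g.hR g.hind).DD (sdir α)
  rw [DD_add svn (((sv 0).mul (sb α 0)).add ((sv 1).mul (sb α 1))) _ hp,
    DD_add ((sv 0).mul (sb α 0)) ((sv 1).mul (sb α 1)) _ hp,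
    DD_mul (sv 0) (sb α 0) _ hp, DD_mul (sv 1) (sb α 1) _ hp, s3] at s4
  have c0 := codazzi' g α β 0 hp
  have c1 := codazzi' g α β 1 hp
  have pd : ∀ f, DD (sdir β) f p = pdS β f p := fun _ => rfl
  simp only [pd] at s4
  rw [s1]
  simp only [ww_eq g _ hp, vNCov2, bCov, Fin.sum_univ_two] at *
  have e1 : vUpCov R 0 β p = pdS β (vUp R 0) p + (chris R 0 β 0 p * vUp R 0 p +
    chris R 0 β 1 p * vUp R 1 p) := by
    simp only [vUpCov, Fin.sum_univ_two, chris_symm g 0 _ β hp]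
  have e2 : vUpCov R 1 β p = pdS β (vUp R 1) p + (chris R 1 β 0 p * vUp R 0 p +
    chris R 1 β 1 p * vUp R 1 p) := by
    simp only [vUpCov, Fin.sum_univ_two, chris_symm g 1 _ β hp]
  rw [bform_symm g 0 β hp, bform_symm g 1 β hp]
  linear_combination s4 + vUp R 0 p * c0 + vUp R 1 p * c1 - bform R α 0 p * e1 - bform R α 1 p * e2 +
    (vUp R 0 p * chris R 1 α β p - vUp R 1 p * chris R 0 α β p) * bform_symm g 0 1 hp

end geom


/-- evolution of the second fundamental form, equation
`eq:curvature evolution`: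
`∂_t b_{αβ} = vⁿ_{,αβ} − vⁿ b^γ_α b_{γβ} + v^γ_{,β} b_{αγ} + v^γ_{,α} b_{γβ} + v^γ b_{αβ,γ}`
on `Ω × I`. -/
theorem statement14 (Ω : Set (ℝ × ℝ)) (I : Set ℝ)
    (hΩ : IsOpen Ω) (hIo : IsOpen I) (hIc : I.OrdConnected)
    (R : Pt → V3)
    (hR : ∀ i : Fin 3, ContDiffOn ℝ (⊤ : ℕ∞) (fun p => R p i) (Ω ×ˢ I))
    (hind : ∀ p ∈ Ω ×ˢ I, LinearIndependent ℝ ![aV R 0 p, aV R 1 p]) :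
    ∀ α β : Fin 2, ∀ p ∈ Ω ×ˢ I,
      pdT (bform R α β) p =
        vNCov2 R α β p
          - vN R p * (∑ γ : Fin 2, bMix R γ α p * bform R γ β p)
          + (∑ γ : Fin 2, vUpCov R γ β p * bform R α γ p)
          + (∑ γ : Fin 2, vUpCov R γ α p * bform R γ β p)
          + ∑ γ : Fin 2, vUp R γ p * bCov R α β γ p := by
  have hU : IsOpen (Ω ×ˢ I) := hΩ.prod hIo
  have g : Geo (Ω ×ˢ I) R := ⟨hU, fun i p hp => (hR i).contDiffAt (hU.mem_nhds hp), hind⟩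
  exact fun α β p hp => main g α β hp
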